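/- Let Λ be a nonempty finite set with N elements, Y a countable linearly ordered set, and for each λ ∈ Λ let M_λ and M'_λ be probability mass functions on Y. Let α ∈ (1,∞), α̂ ∈ [1,∞), ε ≥ 0, ε̂ ≥ 0, θ ∈ (−1,∞), γ ∈ (0,1), and 0 < c ≤ C. Assume that for every λ ∈ Λ one has D_α(M_λ‖M'_λ) ≤ ε, D_α(M'_λ‖M_λ) ≤ ε, D_α̂(M_λ‖M'_λ) ≤ ε̂, and D_α̂(M'_λ‖M_λ) ≤ ε̂. Let (p_k)_{k≥1} be the probability mass function of NegBin(θ,γ), and let σ and σ' be any two adaptive strategies with density bounds (c,C). Then D_α( A(p,σ,M) ‖ A(p,σ',M') ) ≤ ε + (1+θ)·(1 − 1/α̂)·ε̂ + (α/(α−1) + 1 + θ)·log(C/c) + ((1+θ)/α̂)·log(1/γ) + log(E[T])/(α−1), where E[T] is the mean of NegBin(θ,γ). -/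

import Mathlib

open scoped ENNReal BigOperators

/-- KL divergence (order-1 Rényi divergence) between two pmfs, valued in `EReal`. -/
noncomputable def klDiv' {Y : Type*} (p q : Y → ℝ≥0∞) : EReal :=
  open scoped Classical in
  if (∀ y, q y = 0 → p y = 0) ∧
      Summable (fun y => (p y).toReal * Real.log ((p y).toReal / (q y).toReal)) then
    ((∑' y, (p y).toReal * Real.log ((p y).toReal / (q y).toReal) : ℝ) : EReal)
  else ⊤

/-- Rényi divergence of order `α` between two pmfs on a countable set, valued in `EReal`. -/
noncomputable def renyiDiv {Y : Type*} (α : ℝ) (p q : Y → ℝ≥0∞) : EReal :=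
  open scoped Classical in
  if α = 1 then klDiv' p q
  else (((α - 1)⁻¹ : ℝ) : EReal) * ENNReal.log (∑' y, p y ^ α * q y ^ (1 - α))

/-- Probability of generating the sequence `ys` (given history `hist`) in the adaptive
process: at each step, sample `λ` from the strategy applied to the history so far,
then sample the next output from `M λ`. -/
noncomputable def seqProb {Λ Y : Type*} [Fintype Λ]
    (σ : List Y → Λ → ℝ≥0∞) (M : Λ → Y → ℝ≥0∞) : List Y → List Y → ℝ≥0∞
  | _, [] => 1
  | hist, y :: ys => (∑ l : Λ, σ hist l * M l y) * seqProb σ M (hist ++ [y]) ys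

/-- The DP-HyPO output distribution `A(p, σ, M)` : sample `T = k` with probability `p k`
(for `k ≥ 1`), run the adaptive process for `k` steps, and output the maximum. -/
noncomputable def hypoOut {Λ Y : Type*} [Fintype Λ] [LinearOrder Y]
    (p : ℕ → ℝ≥0∞) (σ : List Y → Λ → ℝ≥0∞) (M : Λ → Y → ℝ≥0∞) (y : Y) : ℝ≥0∞ :=
  ∑' k : ℕ, p (k + 1) *
    ∑' l : {l : List Y // l.length = k + 1 ∧ l.maximum = (y : WithBot Y)},
      seqProb σ M [] l.1

/-- `σ` is an adaptive strategy with density bounds `(c, C)`: to every history it assigns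
a probability vector on `Λ` whose entries lie in `[c/N, C/N]` where `N = card Λ`. -/
def IsStrategy {Λ Y : Type*} [Fintype Λ] (c C : ℝ) (σ : List Y → Λ → ℝ≥0∞) : Prop :=
  ∀ h : List Y, (∑ l : Λ, σ h l) = 1 ∧
    ∀ l : Λ, ENNReal.ofReal (c / Fintype.card Λ) ≤ σ h l ∧
      σ h l ≤ ENNReal.ofReal (C / Fintype.card Λ)

/-- The probability mass function of the truncated negative binomial distribution
`NegBin(θ, γ)` at `k`. -/
noncomputable def negBinPMF (θ γ : ℝ) (k : ℕ) : ℝ :=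
  open scoped Classical in
  if θ = 0 then (1 - γ) ^ k / (k * Real.log (1 / γ))
  else (1 - γ) ^ k / (γ ^ (-θ) - 1) * ∏ ℓ ∈ Finset.range k, ((ℓ : ℝ) + θ) / ((ℓ : ℝ) + 1)

/-- The mean of the truncated negative binomial distribution `NegBin(θ, γ)`. -/
noncomputable def negBinMean (θ γ : ℝ) : ℝ :=
  open scoped Classical in
  if θ = 0 then (1 / γ - 1) / Real.log (1 / γ)
  else θ * (1 - γ) / (γ * (1 - γ ^ θ))

/-- Binomial series coefficients. -/
noncomputable def rcoef (θ : ℝ) (k : ℕ) : ℝ := ∏ ℓ ∈ Finset.range k, ((ℓ : ℝ) + 1 + θ) / ((ℓ : ℝ) + 1)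

lemma rcoef_nonneg {θ : ℝ} (hθ : -1 < θ) (k : ℕ) : 0 ≤ rcoef θ k := by
  unfold rcoef
  refine Finset.prod_nonneg fun i _ => ?_
  have : (0:ℝ) ≤ i := Nat.cast_nonneg i
  exact div_nonneg (by linarith) (by linarith)

lemma rcoef_eq (θ : ℝ) (k : ℕ) : rcoef θ k = Ring.choose ((1 + θ) + k - 1) k := by
  rw [← Ring.multichoose_eq]
  have h := Ring.factorial_nsmul_multichoose_eq_ascPochhammer (1 + θ) k
  rw [Polynomial.ascPochhammer_smeval_eq_eval] at h
  have h3 : ∀ n : ℕ, Polynomial.eval (1 + θ) (ascPochhammer ℝ n) =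
      ∏ ℓ ∈ Finset.range n, ((ℓ : ℝ) + 1 + θ) := by
    intro n
    induction n with
    | zero => simp
    | succ n ih => rw [ascPochhammer_succ_eval, ih, Finset.prod_range_succ]; ring
  rw [h3] at h
  unfold rcoef
  rw [Finset.prod_div_distrib]
  have h2 : ∏ x ∈ Finset.range k, ((x:ℝ) + 1) = (k.factorial : ℝ) := by
    rw [← Finset.prod_range_add_one_eq_factorial]; push_cast; rfl
  rw [h2, div_eq_iff (by positivity), mul_comm, ← nsmul_eq_mul, h]

lemma rcoef_hasSum (θ : ℝ) {z : ℝ} (hz0 : 0 ≤ z) (hz1 : z < 1) :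
    HasSum (fun k => rcoef θ k * z ^ k) ((1 - z) ^ (-(1 + θ))) := by
  have h := (Real.one_div_one_sub_rpow_hasFPowerSeriesOnBall_zero (1 + θ)).hasSum (y := z) (by
    rw [← ENNReal.ofReal_one, Metric.eball_ofReal]; simp [abs_of_nonneg hz0, hz1])
  rw [Real.rpow_neg (by linarith)]
  simpa [← rcoef_eq, mul_comm] using h

/-- normalising constant -/
noncomputable def kap (θ γ : ℝ) : ℝ := negBinMean θ γ * γ ^ (1 + θ)

lemma negBinMean_pos {θ γ : ℝ} (hγ0 : 0 < γ) (hγ1 : γ < 1) : 0 < negBinMean θ γ := by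
  unfold negBinMean
  split_ifs with h
  · exact div_pos (by rw [sub_pos]; exact (one_lt_div hγ0).2 hγ1)
      (Real.log_pos ((one_lt_div hγ0).2 hγ1))
  · rcases lt_or_gt_of_ne h with h | h
    · have : 1 < γ ^ θ := Real.one_lt_rpow_of_pos_of_lt_one_of_neg hγ0 hγ1 h
      exact div_pos_of_neg_of_neg (by nlinarith) (by nlinarith)
    · have : γ ^ θ < 1 := Real.rpow_lt_one hγ0.le hγ1 h
      exact div_pos (by nlinarith) (by nlinarith)

lemma kap_pos {θ γ : ℝ} (hγ0 : 0 < γ) (hγ1 : γ < 1) : 0 < kap θ γ :=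
  mul_pos (negBinMean_pos hγ0 hγ1) (Real.rpow_pos_of_pos hγ0 _)

lemma negBin_mul {θ γ : ℝ} (hγ0 : 0 < γ) (hγ1 : γ < 1) (k : ℕ) :
    negBinPMF θ γ (k + 1) * (k + 1) = kap θ γ * (rcoef θ k * (1 - γ) ^ k) := by
  have hk : (0:ℝ) < k + 1 := by positivity
  unfold negBinPMF kap negBinMean
  split_ifs with h
  · subst h
    have hl := (Real.log_pos ((one_lt_div hγ0).2 hγ1)).ne'
    have : rcoef 0 k = 1 := by
      unfold rcoef
      refine Finset.prod_eq_one fun i _ => ?_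
      have : (0:ℝ) < i + 1 := by positivity
      field_simp
      ring
    rw [this]
    simp only [add_zero, Real.rpow_one]
    push_cast
    set L := Real.log (1 / γ)
    field_simp
    ring
  · have h1 : γ ^ (-θ) - 1 ≠ 0 := by
      rw [sub_ne_zero]
      intro h'
      rcases lt_or_gt_of_ne h with h | h
      · exact (Real.rpow_lt_one hγ0.le hγ1 (neg_pos.2 h)).ne h'
      · exact (Real.one_lt_rpow_of_pos_of_lt_one_of_neg hγ0 hγ1 (neg_lt_zero.2 h)).ne' h'
    have h2 : (1 - γ ^ θ) = γ ^ θ * (γ ^ (-θ) - 1) := by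
      rw [mul_sub, ← Real.rpow_add hγ0]; simp
    have hg : γ ^ θ ≠ 0 := (Real.rpow_pos_of_pos hγ0 _).ne'
    have h3 : ((∏ ℓ ∈ Finset.range (k+1), ((ℓ : ℝ) + θ) / ((ℓ : ℝ) + 1))) * (k + 1) = θ * rcoef θ k := by
      unfold rcoef
      rw [Finset.prod_div_distrib, Finset.prod_range_succ' (fun x : ℕ => (x:ℝ) + θ),
        Finset.prod_range_succ (fun x : ℕ => (x:ℝ) + 1), Finset.prod_div_distrib]
      have : ∏ x ∈ Finset.range k, ((x:ℝ) + 1) ≠ 0 := by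
        refine Finset.prod_ne_zero_iff.2 fun i _ => by positivity
      push_cast
      field_simp
      ring
    rw [mul_assoc, h3, h2, Real.rpow_add hγ0, Real.rpow_one]
    set D := γ ^ (-θ) - 1
    field_simp
    ring

lemma negBinPMF_nonneg {θ γ : ℝ} (hθ : -1 < θ) (hγ0 : 0 < γ) (hγ1 : γ < 1) (k : ℕ) :
    0 ≤ negBinPMF θ γ (k + 1) := by
  have h := negBin_mul (θ := θ) hγ0 hγ1 k
  have hk : (0:ℝ) < k + 1 := by positivity
  have : 0 ≤ negBinPMF θ γ (k + 1) * (k + 1) := by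
    rw [h]
    exact mul_nonneg (kap_pos hγ0 hγ1).le (mul_nonneg (rcoef_nonneg hθ k) (pow_nonneg (by linarith) _))
  exact nonneg_of_mul_nonneg_left this hk

/-- derivative of the generating function -/
noncomputable def fder (θ γ x : ℝ) : ℝ := kap θ γ * (1 - (1 - γ) * x) ^ (-(1 + θ))

lemma fder_tsum {θ γ : ℝ} (hθ : -1 < θ) (hγ0 : 0 < γ) (hγ1 : γ < 1) {x : ℝ} (hx0 : 0 ≤ x) (hx1 : x ≤ 1) :
    ∑' k : ℕ, ENNReal.ofReal (negBinPMF θ γ (k + 1)) * ENNReal.ofReal ((k + 1) * x ^ k) =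
      ENNReal.ofReal (fder θ γ x) := by
  have h := (rcoef_hasSum θ (z := (1 - γ) * x) (mul_nonneg (by linarith) hx0) (by nlinarith)).mul_left (kap θ γ)
  have e : ∀ k : ℕ, ENNReal.ofReal (negBinPMF θ γ (k + 1)) * ENNReal.ofReal ((k + 1) * x ^ k) =
      ENNReal.ofReal (kap θ γ * (rcoef θ k * ((1 - γ) * x) ^ k)) := by
    intro k
    rw [← ENNReal.ofReal_mul (negBinPMF_nonneg hθ hγ0 hγ1 k), ← mul_assoc, negBin_mul hγ0 hγ1, mul_pow]
    congr 1; ring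
  simp_rw [e]
  rw [← ENNReal.ofReal_tsum_of_nonneg _ h.summable, h.tsum_eq]
  · rfl
  · intro k
    exact mul_nonneg (kap_pos hγ0 hγ1).le (mul_nonneg (rcoef_nonneg hθ k)
      (pow_nonneg (mul_nonneg (by linarith) hx0) _))

lemma fder_one {θ γ : ℝ} (hγ0 : 0 < γ) : fder θ γ 1 = negBinMean θ γ := by
  unfold fder kap
  rw [mul_one, sub_sub_cancel, mul_assoc, ← Real.rpow_add hγ0]
  simp

/-- the geometric double power sum -/
noncomputable def G (k : ℕ) (a b : ℝ≥0∞) : ℝ≥0∞ := ∑ i ∈ Finset.range (k + 1), a ^ i * b ^ (k - i)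

lemma G_integral (k : ℕ) {a b : ℝ} (ha : 0 ≤ a) (hb : 0 ≤ b) :
    G k (ENNReal.ofReal a) (ENNReal.ofReal b) =
      ∫⁻ s in Set.Ioc (0:ℝ) 1, ENNReal.ofReal ((k + 1) * (b + s * (a - b)) ^ k) := by
  have hint : ∫ s in (0:ℝ)..1, ((k:ℝ) + 1) * (b + s * (a - b)) ^ k =
      ∑ i ∈ Finset.range (k + 1), a ^ i * b ^ (k - i) := by
    by_cases hab : a = b
    · subst hab
      simp only [sub_self, mul_zero, add_zero, intervalIntegral.integral_const, sub_zero, one_smul]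
      rw [Finset.sum_congr rfl (g := fun _ => a ^ k)]
      · simp
      · intro i hi
        rw [← pow_add]; congr 1; have := Finset.mem_range.1 hi; omega
    · have hab' : a - b ≠ 0 := sub_ne_zero.2 hab
      have hd : ∀ s : ℝ, HasDerivAt (fun s => (b + s * (a - b)) ^ (k + 1) / (a - b))
          (((k:ℝ) + 1) * (b + s * (a - b)) ^ k) s := by
        intro s
        have h1 : HasDerivAt (fun s => b + s * (a - b)) (a - b) s := by
          simpa using ((hasDerivAt_id s).mul_const (a - b)).const_add b
        refine ((h1.pow (k + 1)).div_const (a - b)).congr_deriv ?_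
        rw [mul_div_assoc, div_self hab', mul_one, Nat.add_sub_cancel]
        push_cast
        ring
      rw [intervalIntegral.integral_eq_sub_of_hasDerivAt (fun s _ => hd s)
        (Continuous.intervalIntegrable (by fun_prop) _ _)]
      have := geom_sum₂_mul a b (k + 1)
      simp only [Nat.add_sub_cancel] at this
      simp only [one_mul, zero_mul, add_zero, add_sub_cancel]
      rw [← sub_div, ← this, mul_div_assoc, div_self hab', mul_one]
  rw [intervalIntegral.integral_of_le zero_le_one] at hint
  rw [← MeasureTheory.ofReal_integral_eq_lintegral_ofReal, hint]
  · unfold G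
    rw [ENNReal.ofReal_sum_of_nonneg (fun i _ => by positivity)]
    refine Finset.sum_congr rfl fun i _ => ?_
    rw [ENNReal.ofReal_mul (by positivity), ENNReal.ofReal_pow ha, ENNReal.ofReal_pow hb]
  · exact (Continuous.integrableOn_Ioc (by fun_prop))
  · filter_upwards [MeasureTheory.ae_restrict_mem measurableSet_Ioc] with s hs
    have : 0 ≤ b + s * (a - b) := by nlinarith [hs.1, hs.2]
    simp only [Pi.zero_apply]
    positivity

lemma G_tsum {θ γ : ℝ} (hθ : -1 < θ) (hγ0 : 0 < γ) (hγ1 : γ < 1) {a b : ℝ} (ha : 0 ≤ a) (hb : 0 ≤ b)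
    (ha1 : a ≤ 1) (hb1 : b ≤ 1) :
    ∑' k : ℕ, ENNReal.ofReal (negBinPMF θ γ (k + 1)) * G k (ENNReal.ofReal a) (ENNReal.ofReal b) =
      ∫⁻ s in Set.Ioc (0:ℝ) 1, ENNReal.ofReal (fder θ γ (b + s * (a - b))) := by
  simp_rw [G_integral _ ha hb]
  simp_rw [← MeasureTheory.lintegral_const_mul' _ _ ENNReal.ofReal_ne_top]
  rw [← MeasureTheory.lintegral_tsum (fun k => by fun_prop)]
  refine MeasureTheory.setLIntegral_congr_fun measurableSet_Ioc fun s hs => ?_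
  exact fder_tsum hθ hγ0 hγ1 (by nlinarith [hs.1, hs.2]) (by nlinarith [hs.1, hs.2])

lemma G_tsum_le_mean {θ γ : ℝ} (hθ : -1 < θ) (hγ0 : 0 < γ) (hγ1 : γ < 1) {a b : ℝ≥0∞}
    (ha1 : a ≤ 1) (hb1 : b ≤ 1) :
    ∑' k : ℕ, ENNReal.ofReal (negBinPMF θ γ (k + 1)) * G k a b ≤ ENNReal.ofReal (negBinMean θ γ) := by
  rw [← fder_one hγ0, ← fder_tsum hθ hγ0 hγ1 zero_le_one le_rfl]
  refine ENNReal.tsum_le_tsum fun k => ?_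
  gcongr
  unfold G
  refine (Finset.sum_le_sum (g := fun _ => 1) fun i _ => ?_).trans ?_
  · exact mul_le_one' (pow_le_one' ha1 _) (pow_le_one' hb1 _)
  · simp
    rw [ENNReal.ofReal_add (by positivity) (by positivity)]; simp

/-- Key comparison of the two generating functions. -/
lemma G_tsum_compare {θ γ : ℝ} (hθ : -1 < θ) (hγ0 : 0 < γ) (hγ1 : γ < 1) {a b a' b' J : ℝ}
    (ha : 0 ≤ a) (hb : 0 ≤ b) (ha1 : a ≤ 1) (hb1 : b ≤ 1)
    (ha' : 0 ≤ a') (hb' : 0 ≤ b') (ha1' : a' ≤ 1) (hb1' : b' ≤ 1) (hJ : 0 < J)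
    (h1 : 1 - (1 - γ) * a' ≤ J * (1 - (1 - γ) * a))
    (h0 : 1 - (1 - γ) * b' ≤ J * (1 - (1 - γ) * b)) :
    ∑' k : ℕ, ENNReal.ofReal (negBinPMF θ γ (k + 1)) * G k (ENNReal.ofReal a) (ENNReal.ofReal b) ≤
    ENNReal.ofReal (J ^ (1 + θ)) *
    ∑' k : ℕ, ENNReal.ofReal (negBinPMF θ γ (k + 1)) * G k (ENNReal.ofReal a') (ENNReal.ofReal b') := by
  rw [G_tsum hθ hγ0 hγ1 ha hb ha1 hb1, G_tsum hθ hγ0 hγ1 ha' hb' ha1' hb1',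
    ← MeasureTheory.lintegral_const_mul' _ _ ENNReal.ofReal_ne_top]
  refine MeasureTheory.setLIntegral_mono' measurableSet_Ioc fun s hs => ?_
  rw [← ENNReal.ofReal_mul (by positivity)]
  refine ENNReal.ofReal_le_ofReal ?_
  unfold fder
  have hs0 := hs.1
  have hs1 := hs.2
  have hx1 : b + s * (a - b) ≤ 1 := by nlinarith
  have hx1' : b' + s * (a' - b') ≤ 1 := by nlinarith
  have hA : 0 < 1 - (1 - γ) * (b + s * (a - b)) := by nlinarith
  have hB : 0 < 1 - (1 - γ) * (b' + s * (a' - b')) := by nlinarith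
  have hle : 1 - (1 - γ) * (b' + s * (a' - b')) ≤ J * (1 - (1 - γ) * (b + s * (a - b))) := by
    have e1 := mul_le_mul_of_nonneg_left h1 hs0.le
    have e2 := mul_le_mul_of_nonneg_left h0 (sub_nonneg.2 hs1)
    nlinarith
  rw [mul_left_comm]
  refine mul_le_mul_of_nonneg_left ?_ (kap_pos hγ0 hγ1).le
  rw [Real.rpow_neg hA.le, Real.rpow_neg hB.le, ← div_eq_mul_inv, le_div_iff₀ (Real.rpow_pos_of_pos hB _),
    inv_mul_le_iff₀ (Real.rpow_pos_of_pos hA _), mul_comm (_ ^ (1 + θ)) (J ^ (1 + θ)), ← Real.mul_rpow hJ.le hA.le]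
  exact Real.rpow_le_rpow hB.le hle (by linarith)
section process
variable {Λ Y : Type*} [Fintype Λ]

/-- step probability -/
noncomputable def stepP (σ : List Y → Λ → ℝ≥0∞) (M : Λ → Y → ℝ≥0∞) (h : List Y) (z : Y) : ℝ≥0∞ :=
  ∑ l : Λ, σ h l * M l z

lemma tsum_list (F : List Y → ℝ≥0∞) : ∑' l, F l = F [] + ∑' z, ∑' t, F (z :: t) := by
  let e : Option (Y × List Y) ≃ List Y :=
    { toFun := fun o => o.elim [] (fun p => p.1 :: p.2)
      invFun := fun l => match l with
        | [] => none
        | z :: t => some (z, t)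
      left_inv := by rintro (_ | ⟨z, t⟩) <;> rfl
      right_inv := by rintro (_ | ⟨z, t⟩) <;> rfl }
  rw [← e.tsum_eq F, ← ENNReal.tsum_prod]
  rw [ENNReal.tsum_eq_add_tsum_ite none]
  congr 1
  have h2 := (Function.Injective.tsum_eq (Option.some_injective (Y × List Y))
    (f := fun o => if o = none then 0 else F (e o)) (by
      rintro (_ | x) hx
      · simp at hx
      · exact ⟨x, rfl⟩))
  refine Eq.trans (tsum_congr fun o => ?_) (h2.symm.trans ?_)
  · congr
  · rfl

variable [LinearOrder Y]

open scoped Classical in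
/-- all of the next `k` outputs are at most `y` -/
noncomputable def UU (σ : List Y → Λ → ℝ≥0∞) (M : Λ → Y → ℝ≥0∞) (y : Y) (k : ℕ) (h : List Y) : ℝ≥0∞ :=
  ∑' l : List Y, if l.length = k ∧ l.maximum ≤ (y : WithBot Y) then seqProb σ M h l else 0

open scoped Classical in
/-- the maximum of the next `k` outputs is `y` -/
noncomputable def VV (σ : List Y → Λ → ℝ≥0∞) (M : Λ → Y → ℝ≥0∞) (y : Y) (k : ℕ) (h : List Y) : ℝ≥0∞ :=
  ∑' l : List Y, if l.length = k ∧ l.maximum = (y : WithBot Y) then seqProb σ M h l else 0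

lemma UU_zero (σ : List Y → Λ → ℝ≥0∞) (M : Λ → Y → ℝ≥0∞) (y : Y) (h : List Y) : UU σ M y 0 h = 1 := by
  unfold UU
  rw [tsum_list]
  simp [seqProb]

lemma VV_zero (σ : List Y → Λ → ℝ≥0∞) (M : Λ → Y → ℝ≥0∞) (y : Y) (h : List Y) : VV σ M y 0 h = 0 := by
  unfold VV
  rw [tsum_list]
  simp

lemma UU_succ (σ : List Y → Λ → ℝ≥0∞) (M : Λ → Y → ℝ≥0∞) (y : Y) (k : ℕ) (h : List Y) :
    UU σ M y (k + 1) h =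
      ∑' z, if z ≤ y then stepP σ M h z * UU σ M y k (h ++ [z]) else 0 := by
  unfold UU
  rw [tsum_list]
  simp only [List.length_nil, List.length_cons, Nat.add_right_cancel_iff, List.maximum_cons, max_le_iff,
    WithBot.coe_le_coe]
  rw [if_neg (by simp), zero_add]
  refine tsum_congr fun z => ?_
  split_ifs with hz
  · rw [← ENNReal.tsum_mul_left]
    refine tsum_congr fun t => ?_
    simp [hz, seqProb, stepP]
  · simp [hz]

lemma VV_succ (σ : List Y → Λ → ℝ≥0∞) (M : Λ → Y → ℝ≥0∞) (y : Y) (k : ℕ) (h : List Y) :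
    VV σ M y (k + 1) h = stepP σ M h y * UU σ M y k (h ++ [y]) +
      ∑' z, if z < y then stepP σ M h z * VV σ M y k (h ++ [z]) else 0 := by
  have e1 : stepP σ M h y * UU σ M y k (h ++ [y]) =
      ∑' z, if z = y then stepP σ M h z * UU σ M y k (h ++ [z]) else 0 := by
    rw [tsum_ite_eq]
  rw [e1, ← ENNReal.tsum_add]
  conv_lhs => unfold VV
  rw [tsum_list, if_neg (by simp), zero_add]
  refine tsum_congr fun z => ?_
  rcases lt_trichotomy z y with hz | hz | hz
  · rw [if_neg hz.ne, if_pos hz, zero_add]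
    unfold VV
    rw [← ENNReal.tsum_mul_left]
    refine tsum_congr fun t => ?_
    have : max (z : WithBot Y) t.maximum = y ↔ t.maximum = y := by
      have hz' : (z : WithBot Y) < y := WithBot.coe_lt_coe.2 hz
      constructor
      · intro h'
        rcases max_choice (z : WithBot Y) t.maximum with h2 | h2
        · rw [h2] at h'; exact absurd h' hz'.ne
        · rw [← h2, h']
      · intro h'; rw [h']; exact max_eq_right hz'.le
    simp only [List.length_cons, Nat.add_right_cancel_iff, List.maximum_cons, this, mul_ite, mul_zero]
    rfl
  · subst hz
    rw [if_pos rfl, if_neg (lt_irrefl _), add_zero]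
    unfold UU
    rw [← ENNReal.tsum_mul_left]
    refine tsum_congr fun t => ?_
    simp only [List.length_cons, Nat.add_right_cancel_iff, List.maximum_cons, max_eq_left_iff, mul_ite, mul_zero]
    rfl
  · rw [if_neg hz.ne', if_neg hz.not_gt, zero_add]
    rw [ENNReal.tsum_eq_zero]
    intro t
    rw [if_neg]
    rintro ⟨_, h2⟩
    rw [List.maximum_cons] at h2
    have : (z : WithBot Y) ≤ y := h2 ▸ le_max_left _ _
    exact absurd (WithBot.coe_le_coe.1 this) hz.not_ge

lemma hypoOut_eq (p : ℕ → ℝ≥0∞) (σ : List Y → Λ → ℝ≥0∞) (M : Λ → Y → ℝ≥0∞) (y : Y) :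
    hypoOut p σ M y = ∑' k : ℕ, p (k + 1) * VV σ M y (k + 1) [] := by
  unfold hypoOut VV
  refine tsum_congr fun k => ?_
  congr 1
  refine (tsum_subtype {l : List Y | l.length = k + 1 ∧ l.maximum = (y : WithBot Y)} (fun l => seqProb σ M [] l)).trans ?_
  refine tsum_congr fun l => ?_
  simp [Set.indicator_apply]

lemma G_succ (k : ℕ) (a b : ℝ≥0∞) : G (k + 1) a b = a ^ (k + 1) + b * G k a b := by
  unfold G
  rw [Finset.sum_range_succ, add_comm, Finset.mul_sum]
  congr 1
  · simp
  · refine Finset.sum_congr rfl fun i hi => ?_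
    have := Finset.mem_range.1 hi
    rw [show k + 1 - i = (k - i) + 1 by omega, pow_succ]; ring

lemma G_zero (a b : ℝ≥0∞) : G 0 a b = 1 := by simp [G]

lemma UU_le {σ : List Y → Λ → ℝ≥0∞} {M : Λ → Y → ℝ≥0∞} {y : Y} {x1 : ℝ≥0∞}
    (h1 : ∀ h, (∑' z, if z ≤ y then stepP σ M h z else 0) ≤ x1) (k : ℕ) (h : List Y) :
    UU σ M y k h ≤ x1 ^ k := by
  induction k generalizing h with
  | zero => simp [UU_zero]
  | succ k ih =>
    rw [UU_succ]
    calc _ ≤ ∑' z, (if z ≤ y then stepP σ M h z else 0) * x1 ^ k := by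
          refine ENNReal.tsum_le_tsum fun z => ?_
          split_ifs
          · gcongr; exact ih _
          · simp
      _ ≤ _ := by
          rw [ENNReal.tsum_mul_right, pow_succ, mul_comm]; gcongr; exact h1 h

lemma VV_le {σ : List Y → Λ → ℝ≥0∞} {M : Λ → Y → ℝ≥0∞} {y : Y} {x1 x0 u : ℝ≥0∞}
    (h1 : ∀ h, (∑' z, if z ≤ y then stepP σ M h z else 0) ≤ x1)
    (h0 : ∀ h, (∑' z, if z < y then stepP σ M h z else 0) ≤ x0)
    (hu : ∀ h, stepP σ M h y ≤ u) (k : ℕ) (h : List Y) :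
    VV σ M y (k + 1) h ≤ u * G k x1 x0 := by
  induction k generalizing h with
  | zero =>
    rw [VV_succ]
    simp [VV_zero, UU_zero, G_zero, hu h]
  | succ k ih =>
    rw [VV_succ, G_succ, mul_add]
    gcongr
    · exact hu h
    · exact UU_le h1 _ _
    calc _ ≤ ∑' z, (if z < y then stepP σ M h z else 0) * (u * G k x1 x0) := by
          refine ENNReal.tsum_le_tsum fun z => ?_
          split_ifs
          · gcongr; exact ih _
          · simp
      _ ≤ _ := by
          rw [ENNReal.tsum_mul_right, mul_left_comm]; gcongr; exact h0 h

lemma UU_ge {σ : List Y → Λ → ℝ≥0∞} {M : Λ → Y → ℝ≥0∞} {y : Y} {x1 : ℝ≥0∞}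
    (h1 : ∀ h, x1 ≤ (∑' z, if z ≤ y then stepP σ M h z else 0)) (k : ℕ) (h : List Y) :
    x1 ^ k ≤ UU σ M y k h := by
  induction k generalizing h with
  | zero => simp [UU_zero]
  | succ k ih =>
    rw [UU_succ]
    calc _ ≤ ∑' z, (if z ≤ y then stepP σ M h z else 0) * x1 ^ k := by
          rw [ENNReal.tsum_mul_right, pow_succ, mul_comm]; gcongr; exact h1 h
      _ ≤ _ := by
          refine ENNReal.tsum_le_tsum fun z => ?_
          split_ifs
          · gcongr; exact ih _
          · simp

lemma VV_ge {σ : List Y → Λ → ℝ≥0∞} {M : Λ → Y → ℝ≥0∞} {y : Y} {x1 x0 u : ℝ≥0∞}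
    (h1 : ∀ h, x1 ≤ (∑' z, if z ≤ y then stepP σ M h z else 0))
    (h0 : ∀ h, x0 ≤ (∑' z, if z < y then stepP σ M h z else 0))
    (hu : ∀ h, u ≤ stepP σ M h y) (k : ℕ) (h : List Y) :
    u * G k x1 x0 ≤ VV σ M y (k + 1) h := by
  induction k generalizing h with
  | zero =>
    rw [VV_succ]
    simp [VV_zero, UU_zero, G_zero, hu h]
  | succ k ih =>
    rw [VV_succ, G_succ, mul_add]
    gcongr
    · exact hu h
    · exact UU_ge h1 _ _
    calc _ ≤ ∑' z, (if z < y then stepP σ M h z else 0) * (u * G k x1 x0) := by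
          rw [ENNReal.tsum_mul_right, mul_left_comm]; gcongr; exact h0 h
      _ ≤ _ := by
          refine ENNReal.tsum_le_tsum fun z => ?_
          split_ifs
          · gcongr; exact ih _
          · simp
end process
section renyi
variable {ι : Type*}

lemma holder_aux (v p q : ι → ℝ≥0∞) {a : ℝ} (ha : 1 < a) (hv : ∀ i, v i ≠ ⊤) (hp : ∀ i, p i ≠ ⊤)
    (hq : ∀ i, q i ≠ ⊤) (hS : ∑' i, v i * (p i ^ a * q i ^ (1 - a)) ≠ ⊤) :
    ∑' i, v i * p i ≤ (∑' i, v i * (p i ^ a * q i ^ (1 - a))) ^ (1 / a) * (∑' i, v i * q i) ^ (1 - 1 / a) := by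
  have ha0 : 0 < a := by linarith
  have h1a : 0 < 1 - 1 / a := by
    rw [sub_pos, div_lt_one ha0]; exact ha
  have hpt : ∀ i, v i * p i ≤
      (v i * (p i ^ a * q i ^ (1 - a))) ^ (1 / a) * (v i * q i) ^ (1 - 1 / a) := by
    intro i
    by_cases hv0 : v i = 0
    · simp [hv0]
    by_cases hp0 : p i = 0
    · simp [hp0]
    by_cases hq0 : q i = 0
    · exfalso
      refine ENNReal.ne_top_of_tsum_ne_top hS i ?_
      rw [hq0, ENNReal.zero_rpow_of_neg (by linarith), ENNReal.mul_top, ENNReal.mul_top hv0]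
      simp [ENNReal.rpow_eq_zero_iff, hp0, hp i]
    rw [ENNReal.mul_rpow_of_nonneg _ _ (by positivity), ENNReal.mul_rpow_of_nonneg _ _ (by positivity),
      ENNReal.mul_rpow_of_nonneg _ _ h1a.le, ← ENNReal.rpow_mul, ← ENNReal.rpow_mul,
      mul_one_div_cancel ha0.ne', ENNReal.rpow_one]
    have e1 : v i ^ (1 / a) * v i ^ (1 - 1 / a) = v i := by
      rw [← ENNReal.rpow_add _ _ hv0 (hv i)]; simp
    have e2 : q i ^ ((1 - a) * (1 / a)) * q i ^ (1 - 1 / a) = 1 := by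
      rw [← ENNReal.rpow_add _ _ hq0 (hq i)]
      have : (1 - a) * (1 / a) + (1 - 1 / a) = 0 := by field_simp; ring
      rw [this, ENNReal.rpow_zero]
    calc v i * p i = (v i ^ (1 / a) * v i ^ (1 - 1 / a)) * p i *
          (q i ^ ((1 - a) * (1 / a)) * q i ^ (1 - 1 / a)) := by rw [e1, e2, mul_one]
      _ ≤ _ := le_of_eq (by ring)
  rw [ENNReal.tsum_eq_iSup_sum]
  refine iSup_le fun s => ?_
  have hpq : a.HolderConjugate ((1 - 1 / a)⁻¹) := by
    rw [Real.holderConjugate_iff]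
    refine ⟨ha, ?_⟩
    rw [inv_inv]; field_simp; ring
  refine (Finset.sum_le_sum fun i _ => hpt i).trans ?_
  refine (ENNReal.inner_le_Lp_mul_Lq s _ _ hpq).trans ?_
  simp_rw [← ENNReal.rpow_mul]
  rw [one_div_mul_cancel ha0.ne', mul_inv_cancel₀ h1a.ne', one_div (1 - 1 / a)⁻¹, inv_inv]
  simp_rw [ENNReal.rpow_one]
  gcongr
  · exact ENNReal.sum_le_tsum _
  · exact ENNReal.sum_le_tsum _

lemma rpow_cancel_le (x : ℝ≥0∞) (a : ℝ) : x ^ a * x ^ (-a) ≤ 1 := by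
  by_cases h0 : x = 0
  · subst h0
    rcases lt_trichotomy a 0 with h | h | h
    · rw [ENNReal.zero_rpow_of_pos (neg_pos.2 h)]; simp
    · simp [h]
    · rw [ENNReal.zero_rpow_of_pos h]; simp
  by_cases ht : x = ⊤
  · subst ht
    rcases lt_trichotomy a 0 with h | h | h
    · rw [ENNReal.top_rpow_of_neg h]; simp
    · simp [h]
    · rw [ENNReal.top_rpow_of_neg (neg_lt_zero.2 h)]; simp
  rw [← ENNReal.rpow_add _ _ h0 ht]; simp

lemma rpow_anti {x y : ℝ≥0∞} {z : ℝ} (hz : 0 ≤ z) (h : x ≤ y) : y ^ (-z) ≤ x ^ (-z) := by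
  rw [ENNReal.rpow_neg, ENNReal.rpow_neg, ENNReal.inv_le_inv]
  exact ENNReal.rpow_le_rpow h hz

lemma sum_le_of_renyiDiv_le {p q : ι → ℝ≥0∞} {a ε : ℝ} (ha : 1 < a)
    (h : renyiDiv a p q ≤ (ε : EReal)) :
    ∑' y, p y ^ a * q y ^ (1 - a) ≤ ENNReal.ofReal (Real.exp ((a - 1) * ε)) := by
  unfold renyiDiv at h
  rw [if_neg ha.ne'] at h
  set S := ∑' y, p y ^ a * q y ^ (1 - a)
  have hi : 0 < (a - 1)⁻¹ := inv_pos.2 (by linarith)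
  by_cases h0 : S = 0
  · simp [h0]
  by_cases ht : S = ⊤
  · exfalso
    rw [ht, ENNReal.log_top, EReal.coe_mul_top_of_pos hi] at h
    exact absurd h (by simp)
  rw [ENNReal.log_pos_real h0 ht, ← EReal.coe_mul, EReal.coe_le_coe_iff,
    inv_mul_le_iff₀ (by linarith)] at h
  rw [← ENNReal.ofReal_toReal ht]
  refine ENNReal.ofReal_le_ofReal ?_
  rwa [← Real.log_le_iff_le_exp (ENNReal.toReal_pos h0 ht)]

lemma renyiDiv_le_of_sum_le {p q : ι → ℝ≥0∞} {a B : ℝ} (ha : 1 < a)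
    (h : ∑' y, p y ^ a * q y ^ (1 - a) ≤ ENNReal.ofReal (Real.exp ((a - 1) * B))) :
    renyiDiv a p q ≤ (B : EReal) := by
  unfold renyiDiv
  rw [if_neg ha.ne']
  have hi : 0 < (a - 1)⁻¹ := inv_pos.2 (by linarith)
  have h2 := ENNReal.log_le_log h
  rw [ENNReal.log_ofReal_of_pos (Real.exp_pos _), Real.log_exp] at h2
  have h3 : (B : EReal) = (((a - 1)⁻¹ : ℝ) : EReal) * (((a - 1) * B : ℝ) : EReal) := by
    rw [← EReal.coe_mul, inv_mul_cancel_left₀ (by linarith)]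
  rw [h3]
  exact mul_le_mul_of_nonneg_left h2 (EReal.coe_nonneg.2 hi.le)

/-- the ratio constant -/
noncomputable def JJ (αh εh γ : ℝ) : ℝ := Real.exp ((1 - 1 / αh) * εh) * γ ^ (-(1 / αh))

lemma JJ_pos {αh εh γ : ℝ} (hγ0 : 0 < γ) : 0 < JJ αh εh γ :=
  mul_pos (Real.exp_pos _) (Real.rpow_pos_of_pos hγ0 _)

lemma dataproc {αh εh γ : ℝ} (hαh : 1 ≤ αh) (hγ0 : 0 < γ)
    {P Q v : ι → ℝ≥0∞} (hP : ∑' y, P y = 1) (hQ : ∑' y, Q y = 1)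
    (h : renyiDiv αh P Q ≤ (εh : EReal)) (hv0 : ∀ y, ENNReal.ofReal γ ≤ v y) (hv1 : ∀ y, v y ≤ 1) :
    ∑' y, v y * P y ≤ ENNReal.ofReal (JJ αh εh γ) * ∑' y, v y * Q y := by
  have hg0 : ENNReal.ofReal γ ≠ 0 := by simp [hγ0]
  have hQg : ENNReal.ofReal γ ≤ ∑' y, v y * Q y := by
    calc ENNReal.ofReal γ = ∑' y, ENNReal.ofReal γ * Q y := by rw [ENNReal.tsum_mul_left, hQ, mul_one]
      _ ≤ _ := ENNReal.tsum_le_tsum fun y => by gcongr; exact hv0 y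
  have hle1 : ∀ R : ι → ℝ≥0∞, ∑' y, R y = 1 → ∑' y, v y * R y ≤ 1 := by
    intro R hR
    rw [← hR]
    exact ENNReal.tsum_le_tsum fun y => mul_le_of_le_one_left' (hv1 y)
  have hJ : ENNReal.ofReal (JJ αh εh γ) =
      ENNReal.ofReal (Real.exp ((1 - 1 / αh) * εh)) * ENNReal.ofReal γ ^ (-(1 / αh)) := by
    unfold JJ
    rw [ENNReal.ofReal_mul (Real.exp_pos _).le, ENNReal.ofReal_rpow_of_pos hγ0]
  rcases hαh.eq_or_lt with h1 | h1
  · rw [hJ, ← h1]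
    refine (hle1 P hP).trans ?_
    simp only [div_one, sub_self, zero_mul, Real.exp_zero, ENNReal.ofReal_one, one_mul, ENNReal.rpow_neg_one]
    calc (1 : ℝ≥0∞) = (ENNReal.ofReal γ)⁻¹ * ENNReal.ofReal γ :=
          (ENNReal.inv_mul_cancel hg0 ENNReal.ofReal_ne_top).symm
      _ ≤ _ := by gcongr
  · have ha0 : 0 < αh := by linarith
    have hS := sum_le_of_renyiDiv_le h1 h
    have hT : ∑' y, v y * (P y ^ αh * Q y ^ (1 - αh)) ≤ ENNReal.ofReal (Real.exp ((αh - 1) * εh)) :=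
      (ENNReal.tsum_le_tsum fun y => mul_le_of_le_one_left' (hv1 y)).trans hS
    have hfin : ∀ R : ι → ℝ≥0∞, ∑' y, R y = 1 → ∀ y, R y ≠ ⊤ := fun R hR y =>
      ENNReal.ne_top_of_tsum_ne_top (by rw [hR]; simp) y
    refine (holder_aux v P Q h1 (fun y => ne_top_of_le_ne_top ENNReal.one_ne_top (hv1 y))
      (hfin P hP) (hfin Q hQ) (ne_top_of_le_ne_top ENNReal.ofReal_ne_top hT)).trans ?_
    set A := ∑' y, v y * Q y
    have hA0 : A ≠ 0 := fun h => hg0 (by rw [h] at hQg; exact le_antisymm hQg bot_le)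
    have hAt : A ≠ ⊤ := ne_top_of_le_ne_top ENNReal.one_ne_top (hle1 Q hQ)
    have e1 : (∑' y, v y * (P y ^ αh * Q y ^ (1 - αh))) ^ (1 / αh) ≤
        ENNReal.ofReal (Real.exp ((1 - 1 / αh) * εh)) := by
      refine (ENNReal.rpow_le_rpow hT (by positivity)).trans ?_
      rw [ENNReal.ofReal_rpow_of_pos (Real.exp_pos _), ← Real.exp_mul]
      refine ENNReal.ofReal_le_ofReal (le_of_eq ?_)
      congr 1; field_simp
    have e2 : A ^ (1 - 1 / αh) ≤ ENNReal.ofReal γ ^ (-(1 / αh)) * A := by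
      rw [sub_eq_neg_add, ENNReal.rpow_add _ _ hA0 hAt, ENNReal.rpow_one]
      gcongr ?_ * _
      exact rpow_anti (by positivity) hQg
    rw [hJ, mul_assoc]
    gcongr

end renyi
section avg
variable {Λ Y : Type*} [Fintype Λ]

/-- the uniform mixture -/
noncomputable def BB (M : Λ → Y → ℝ≥0∞) (z : Y) : ℝ≥0∞ := ∑ l : Λ, (Fintype.card Λ : ℝ≥0∞)⁻¹ * M l z

open scoped Classical in
/-- mass of a set under a weight -/
noncomputable def msum (m : Y → ℝ≥0∞) (S : Y → Prop) : ℝ≥0∞ := ∑' z, if S z then m z else 0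

lemma msum_le (m : Y → ℝ≥0∞) (S : Y → Prop) : msum m S ≤ ∑' z, m z := by
  classical
  exact ENNReal.tsum_le_tsum fun z => by split_ifs <;> simp

lemma msum_compl (m : Y → ℝ≥0∞) (S : Y → Prop) : msum m (fun z => ¬ S z) + msum m S = ∑' z, m z := by
  classical
  unfold msum
  rw [← ENNReal.tsum_add]
  refine tsum_congr fun z => ?_
  by_cases h : S z <;> simp [h]

lemma msum_mono {m m' : Y → ℝ≥0∞} (h : ∀ z, m z ≤ m' z) (S : Y → Prop) : msum m S ≤ msum m' S := by
  classical
  exact ENNReal.tsum_le_tsum fun z => by split_ifs <;> simp [h]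

lemma msum_mul (a : ℝ≥0∞) (m : Y → ℝ≥0∞) (S : Y → Prop) : msum (fun z => a * m z) S = a * msum m S := by
  classical
  unfold msum
  rw [← ENNReal.tsum_mul_left]
  exact tsum_congr fun z => by split_ifs <;> simp

variable [Nonempty Λ]

lemma ofReal_div_card (a : ℝ) : ENNReal.ofReal (a / Fintype.card Λ) =
    ENNReal.ofReal a * (Fintype.card Λ : ℝ≥0∞)⁻¹ := by
  rw [ENNReal.ofReal_div_of_pos (by exact_mod_cast Fintype.card_pos), ENNReal.ofReal_natCast, div_eq_mul_inv]

lemma card_sum_inv : ∑ _l : Λ, (Fintype.card Λ : ℝ≥0∞)⁻¹ = 1 := by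
  simp only [Finset.sum_const, Finset.card_univ, nsmul_eq_mul]
  exact ENNReal.mul_inv_cancel (by simp) (by simp)

lemma BB_sum {M : Λ → Y → ℝ≥0∞} (hM : ∀ l, ∑' y, M l y = 1) : ∑' y, BB M y = 1 := by
  unfold BB
  rw [Summable.tsum_finsetSum (fun _ _ => ENNReal.summable)]
  simp_rw [ENNReal.tsum_mul_left, hM, mul_one]
  exact card_sum_inv

lemma stepP_sum {c C : ℝ} {σ : List Y → Λ → ℝ≥0∞} (hσ : IsStrategy c C σ) {M : Λ → Y → ℝ≥0∞}
    (hM : ∀ l, ∑' y, M l y = 1) (h : List Y) : ∑' y, stepP σ M h y = 1 := by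
  unfold stepP
  rw [Summable.tsum_finsetSum (fun _ _ => ENNReal.summable)]
  simp_rw [ENNReal.tsum_mul_left, hM, mul_one]
  exact (hσ h).1

lemma stepP_le {c C : ℝ} {σ : List Y → Λ → ℝ≥0∞} (hσ : IsStrategy c C σ) (M : Λ → Y → ℝ≥0∞)
    (h : List Y) (y : Y) : stepP σ M h y ≤ ENNReal.ofReal C * BB M y := by
  unfold stepP BB
  rw [Finset.mul_sum]
  refine Finset.sum_le_sum fun l _ => ?_
  rw [← mul_assoc, ← ofReal_div_card]
  gcongr
  exact ((hσ h).2 l).2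

lemma le_stepP {c C : ℝ} {σ : List Y → Λ → ℝ≥0∞} (hσ : IsStrategy c C σ) (M : Λ → Y → ℝ≥0∞)
    (h : List Y) (y : Y) : ENNReal.ofReal c * BB M y ≤ stepP σ M h y := by
  unfold stepP BB
  rw [Finset.mul_sum]
  refine Finset.sum_le_sum fun l _ => ?_
  rw [← mul_assoc, ← ofReal_div_card]
  gcongr
  exact ((hσ h).2 l).1

lemma c_le_one {c C : ℝ} {σ : List Y → Λ → ℝ≥0∞} (hσ : IsStrategy c C σ) : c ≤ 1 := by
  have h1 : ENNReal.ofReal c ≤ 1 := by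
    rw [← (hσ []).1, ← mul_one (ENNReal.ofReal c), ← card_sum_inv (Λ := Λ), Finset.mul_sum]
    refine Finset.sum_le_sum fun l _ => ?_
    rw [← ofReal_div_card]
    exact ((hσ []).2 l).1
  simpa using h1

lemma one_le_C {c C : ℝ} {σ : List Y → Λ → ℝ≥0∞} (hσ : IsStrategy c C σ) : 1 ≤ C := by
  have h1 : 1 ≤ ENNReal.ofReal C := by
    rw [← (hσ []).1, ← mul_one (ENNReal.ofReal C), ← card_sum_inv (Λ := Λ), Finset.mul_sum]
    refine Finset.sum_le_sum fun l _ => ?_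
    rw [← ofReal_div_card]
    exact ((hσ []).2 l).2
  simpa using h1

lemma msum_step_le {c C : ℝ} {σ : List Y → Λ → ℝ≥0∞} (hσ : IsStrategy c C σ) {M : Λ → Y → ℝ≥0∞}
    (hM : ∀ l, ∑' y, M l y = 1) (S : Y → Prop) (h : List Y) :
    msum (stepP σ M h) (fun z => ¬ S z) ≤ 1 - ENNReal.ofReal c * msum (BB M) S := by
  have hfin : ENNReal.ofReal c * msum (BB M) S ≠ ⊤ :=
    ENNReal.mul_ne_top ENNReal.ofReal_ne_top
      (ne_top_of_le_ne_top (by rw [BB_sum hM]; simp) (msum_le (BB M) S))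
  refine ENNReal.le_sub_of_add_le_right hfin ?_
  rw [← stepP_sum hσ hM h, ← msum_compl (stepP σ M h) S, ← msum_mul]
  gcongr
  exact msum_mono (le_stepP hσ M h) S

lemma le_msum_step {c C : ℝ} {σ : List Y → Λ → ℝ≥0∞} (hσ : IsStrategy c C σ) {M : Λ → Y → ℝ≥0∞}
    (hM : ∀ l, ∑' y, M l y = 1) (S : Y → Prop) (h : List Y) :
    1 - ENNReal.ofReal C * msum (BB M) S ≤ msum (stepP σ M h) (fun z => ¬ S z) := by
  rw [tsub_le_iff_right]
  rw [← stepP_sum hσ hM h, ← msum_compl (stepP σ M h) S, ← msum_mul]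
  gcongr
  exact msum_mono (stepP_le hσ M h) S

lemma BB_dataproc {αh εh γ : ℝ} (hαh : 1 ≤ αh) (hγ0 : 0 < γ) (hγ1 : γ < 1)
    {M M' : Λ → Y → ℝ≥0∞} (hM : ∀ l, ∑' y, M l y = 1) (hM' : ∀ l, ∑' y, M' l y = 1)
    (h : ∀ l, renyiDiv αh (M' l) (M l) ≤ (εh : EReal)) (S : Y → Prop) :
    γ + (1 - γ) * (msum (BB M') S).toReal ≤ JJ αh εh γ * (γ + (1 - γ) * (msum (BB M) S).toReal) := by
  classical
  let v : Y → ℝ≥0∞ := fun z => ENNReal.ofReal γ + ENNReal.ofReal (1 - γ) * (if S z then 1 else 0)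
  have hv0 : ∀ z, ENNReal.ofReal γ ≤ v z := fun z => le_self_add
  have hv1 : ∀ z, v z ≤ 1 := by
    intro z
    have : ENNReal.ofReal γ + ENNReal.ofReal (1 - γ) = 1 := by
      rw [← ENNReal.ofReal_add hγ0.le (by linarith)]; simp
    rw [← this]
    simp only [v]
    gcongr
    split_ifs <;> simp
  have hkey : ∑' z, v z * BB M' z ≤ ENNReal.ofReal (JJ αh εh γ) * ∑' z, v z * BB M z := by
    have e : ∀ K : Λ → Y → ℝ≥0∞, ∑' z, v z * BB K z =
        ∑ l : Λ, (Fintype.card Λ : ℝ≥0∞)⁻¹ * ∑' z, v z * K l z := by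
      intro K
      simp_rw [← ENNReal.tsum_mul_left]
      rw [← Summable.tsum_finsetSum (fun _ _ => ENNReal.summable)]
      refine tsum_congr fun z => ?_
      unfold BB
      rw [Finset.mul_sum]
      exact Finset.sum_congr rfl fun l _ => by ring
    rw [e, e, Finset.mul_sum]
    refine Finset.sum_le_sum fun l _ => ?_
    rw [mul_left_comm]
    gcongr
    exact dataproc hαh hγ0 (hM' l) (hM l) (h l) hv0 hv1
  have e2 : ∀ K : Λ → Y → ℝ≥0∞, (∀ l, ∑' y, K l y = 1) → ∑' z, v z * BB K z =
      ENNReal.ofReal (γ + (1 - γ) * (msum (BB K) S).toReal) := by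
    intro K hK
    have hfin : msum (BB K) S ≠ ⊤ := ne_top_of_le_ne_top (by rw [BB_sum hK]; simp) (msum_le (BB K) S)
    rw [ENNReal.ofReal_add hγ0.le (mul_nonneg (by linarith) ENNReal.toReal_nonneg),
      ENNReal.ofReal_mul (by linarith), ENNReal.ofReal_toReal hfin]
    simp only [v, add_mul]
    rw [ENNReal.tsum_add, ENNReal.tsum_mul_left, BB_sum hK, mul_one]
    simp_rw [mul_assoc]
    rw [ENNReal.tsum_mul_left]
    congr 2
    unfold msum
    exact tsum_congr fun z => by split_ifs <;> simp
  rw [e2 M hM, e2 M' hM', ← ENNReal.ofReal_mul (JJ_pos hγ0).le] at hkey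
  rwa [ENNReal.ofReal_le_ofReal_iff] at hkey
  exact mul_nonneg (JJ_pos hγ0).le (add_nonneg hγ0.le (mul_nonneg (by linarith) ENNReal.toReal_nonneg))

lemma key_ineq {αh εh γ c C : ℝ} (hαh : 1 ≤ αh) (hγ0 : 0 < γ) (hγ1 : γ < 1) (hc : 0 < c) (hc1 : c ≤ 1)
    (hC1 : 1 ≤ C)
    {M M' : Λ → Y → ℝ≥0∞} (hM : ∀ l, ∑' y, M l y = 1) (hM' : ∀ l, ∑' y, M' l y = 1)
    (h : ∀ l, renyiDiv αh (M' l) (M l) ≤ (εh : EReal)) (S : Y → Prop) :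
    1 - (1 - γ) * (1 - ENNReal.ofReal C * msum (BB M') S).toReal ≤
      (C / c * JJ αh εh γ) * (1 - (1 - γ) * (1 - ENNReal.ofReal c * msum (BB M) S).toReal) := by
  have hb := BB_dataproc hαh hγ0 hγ1 hM hM' h S
  have hle : ∀ K : Λ → Y → ℝ≥0∞, (∀ l, ∑' y, K l y = 1) → msum (BB K) S ≤ 1 := fun K hK => by
    rw [← BB_sum hK]; exact msum_le _ _
  have hfin : ∀ K : Λ → Y → ℝ≥0∞, (∀ l, ∑' y, K l y = 1) → msum (BB K) S ≠ ⊤ := fun K hK =>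
    ne_top_of_le_ne_top ENNReal.one_ne_top (hle K hK)
  have hJ := JJ_pos (αh := αh) (εh := εh) hγ0
  have h1 : 1 - C * (msum (BB M') S).toReal ≤ (1 - ENNReal.ofReal C * msum (BB M') S).toReal := by
    have := ENNReal.le_toReal_sub (a := 1) (b := ENNReal.ofReal C * msum (BB M') S)
      (ENNReal.mul_ne_top ENNReal.ofReal_ne_top (hfin M' hM'))
    rwa [ENNReal.toReal_mul, ENNReal.toReal_ofReal (by linarith), ENNReal.toReal_one] at this
  have h2 : (1 - ENNReal.ofReal c * msum (BB M) S).toReal = 1 - c * (msum (BB M) S).toReal := by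
    rw [ENNReal.toReal_sub_of_le _ ENNReal.one_ne_top, ENNReal.toReal_mul, ENNReal.toReal_ofReal hc.le,
      ENNReal.toReal_one]
    exact mul_le_one' (by simpa using hc1) (hle M hM)
  rw [h2]
  set P := (msum (BB M) S).toReal
  set P' := (msum (BB M') S).toReal
  have hP : 0 ≤ P := ENNReal.toReal_nonneg
  calc _ ≤ 1 - (1 - γ) * (1 - C * P') := by
        have := mul_le_mul_of_nonneg_left h1 (by linarith : 0 ≤ 1 - γ)
        linarith
    _ ≤ C * (γ + (1 - γ) * P') := by nlinarith
    _ ≤ C * (JJ αh εh γ * (γ + (1 - γ) * P)) := by gcongr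
    _ = (C / c * JJ αh εh γ) * (c * (γ + (1 - γ) * P)) := by field_simp
    _ ≤ _ := by
        refine mul_le_mul_of_nonneg_left ?_ (by positivity)
        nlinarith

/-- joint convexity for the mixture -/
lemma BB_convex {α ε : ℝ} (hα : 1 < α)
    {M M' : Λ → Y → ℝ≥0∞} (hM : ∀ l, ∑' y, M l y = 1) (hM' : ∀ l, ∑' y, M' l y = 1)
    (h : ∀ l, renyiDiv α (M l) (M' l) ≤ (ε : EReal)) :
    ∑' y, BB M y ^ α * BB M' y ^ (1 - α) ≤ ENNReal.ofReal (Real.exp ((α - 1) * ε)) := by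
  have hS : ∀ l, ∑' y, M l y ^ α * M' l y ^ (1 - α) ≤ ENNReal.ofReal (Real.exp ((α - 1) * ε)) :=
    fun l => sum_le_of_renyiDiv_le hα (h l)
  have hα0 : 0 < α := by linarith
  have hpt : ∀ y, BB M y ^ α * BB M' y ^ (1 - α) ≤
      ∑ l, (Fintype.card Λ : ℝ≥0∞)⁻¹ * (M l y ^ α * M' l y ^ (1 - α)) := by
    intro y
    have hh := holder_aux (fun _ : Λ => (Fintype.card Λ : ℝ≥0∞)⁻¹) (fun l => M l y) (fun l => M' l y) hα
      (fun _ => by simp)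
      (fun l => ENNReal.ne_top_of_tsum_ne_top (by rw [hM l]; simp) y)
      (fun l => ENNReal.ne_top_of_tsum_ne_top (by rw [hM' l]; simp) y)
      (by
        rw [tsum_fintype]
        refine ENNReal.sum_ne_top.2 fun l _ => ENNReal.mul_ne_top (by simp) ?_
        exact ENNReal.ne_top_of_tsum_ne_top (ne_top_of_le_ne_top ENNReal.ofReal_ne_top (hS l)) y)
    simp only [tsum_fintype] at hh
    set T := ∑ l, (Fintype.card Λ : ℝ≥0∞)⁻¹ * (M l y ^ α * M' l y ^ (1 - α))
    change BB M y ≤ T ^ (1 / α) * BB M' y ^ (1 - 1 / α) at hh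
    have h2 : BB M y ^ α ≤ T * BB M' y ^ (α - 1) := by
      refine (ENNReal.rpow_le_rpow hh hα0.le).trans (le_of_eq ?_)
      rw [ENNReal.mul_rpow_of_nonneg _ _ hα0.le, ← ENNReal.rpow_mul, ← ENNReal.rpow_mul,
        one_div_mul_cancel hα0.ne', ENNReal.rpow_one]
      congr 2; field_simp
    calc _ ≤ (T * BB M' y ^ (α - 1)) * BB M' y ^ (1 - α) := by gcongr
      _ = T * (BB M' y ^ (α - 1) * BB M' y ^ (-(α - 1))) := by rw [mul_assoc, neg_sub]
      _ ≤ T * 1 := by gcongr; exact rpow_cancel_le _ _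
      _ = T := mul_one _
  refine (ENNReal.tsum_le_tsum hpt).trans ?_
  rw [Summable.tsum_finsetSum (fun _ _ => ENNReal.summable)]
  simp_rw [ENNReal.tsum_mul_left]
  calc _ ≤ ∑ l : Λ, (Fintype.card Λ : ℝ≥0∞)⁻¹ * ENNReal.ofReal (Real.exp ((α - 1) * ε)) := by
        refine Finset.sum_le_sum fun l _ => ?_
        gcongr
        exact hS l
    _ = _ := by rw [← Finset.sum_mul, card_sum_inv, one_mul]

end avg

lemma pointwise_bound {A A' B B' I I' c C K E : ℝ≥0∞} {α : ℝ} (hα : 1 < α)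
    (hA : A ≤ C * B * I) (hA' : c * B' * I' ≤ A') (hIK : I ≤ K * I') (hIE : I ≤ E)
    (hc : c ≠ ⊤) (hB' : B' ≠ ⊤) (hI' : I' ≠ ⊤) :
    A ^ α * A' ^ (1 - α) ≤ (C ^ α * c ^ (1 - α) * E * K ^ (α - 1)) * (B ^ α * B' ^ (1 - α)) := by
  have h1 : A ^ α ≤ C ^ α * B ^ α * (E * (K ^ (α - 1) * I' ^ (α - 1))) := by
    refine (ENNReal.rpow_le_rpow hA (by linarith)).trans ?_
    rw [ENNReal.mul_rpow_of_nonneg _ _ (by linarith), ENNReal.mul_rpow_of_nonneg _ _ (by linarith)]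
    gcongr
    have : I ^ α = I * I ^ (α - 1) := by
      conv_lhs => rw [show α = 1 + (α - 1) by ring]
      rw [ENNReal.rpow_add_of_nonneg _ _ zero_le_one (by linarith), ENNReal.rpow_one]
    rw [this, ← ENNReal.mul_rpow_of_nonneg _ _ (by linarith : 0 ≤ α - 1)]
    gcongr
  have h2 : A' ^ (1 - α) ≤ c ^ (1 - α) * B' ^ (1 - α) * I' ^ (1 - α) := by
    rw [← ENNReal.mul_rpow_of_ne_top hc hB', ← ENNReal.mul_rpow_of_ne_top (ENNReal.mul_ne_top hc hB') hI',
      ← neg_sub α 1]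
    exact rpow_anti (by linarith) hA'
  calc _ ≤ (C ^ α * B ^ α * (E * (K ^ (α - 1) * I' ^ (α - 1)))) *
        (c ^ (1 - α) * B' ^ (1 - α) * I' ^ (1 - α)) := by gcongr
    _ = (C ^ α * c ^ (1 - α) * E * K ^ (α - 1)) * (B ^ α * B' ^ (1 - α)) *
        (I' ^ (α - 1) * I' ^ (-(α - 1))) := by rw [neg_sub]; ring
    _ ≤ (C ^ α * c ^ (1 - α) * E * K ^ (α - 1)) * (B ^ α * B' ^ (1 - α)) * 1 := by
        gcongr; exact rpow_cancel_le _ _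
    _ = _ := mul_one _

lemma final_const {α αh ε εh θ γ c C E : ℝ} (hα : 1 < α) (hγ0 : 0 < γ) (hc : 0 < c) (hc1 : c ≤ 1)
    (hC : 0 < C) (hE : 0 < E) :
    C ^ α * c ^ (1 - α) * E * ((C / c * JJ αh εh γ) ^ (1 + θ)) ^ (α - 1) * Real.exp ((α - 1) * ε) ≤
      Real.exp ((α - 1) * (ε + (1 + θ) * (1 - 1 / αh) * εh + (α / (α - 1) + 1 + θ) * Real.log (C / c)
        + (1 + θ) / αh * Real.log (1 / γ) + Real.log E / (α - 1))) := by
  have hJ := JJ_pos (αh := αh) (εh := εh) hγ0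
  have hCc : 0 < C / c := div_pos hC hc
  rw [← Real.log_le_iff_le_exp (by positivity)]
  rw [Real.log_mul (by positivity) (by positivity), Real.log_mul (by positivity) (by positivity),
    Real.log_mul (by positivity) (by positivity), Real.log_mul (by positivity) (by positivity),
    Real.log_rpow hC, Real.log_rpow hc, Real.log_rpow (by positivity), Real.log_rpow (by positivity),
    Real.log_mul hCc.ne' hJ.ne', Real.log_exp]
  have hlJ : Real.log (JJ αh εh γ) = (1 - 1 / αh) * εh + 1 / αh * Real.log (1 / γ) := by
    unfold JJ
    rw [Real.log_mul (by positivity) (by positivity), Real.log_exp, Real.log_rpow hγ0, one_div γ, Real.log_inv]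
    ring
  have hlc : Real.log c ≤ 0 := Real.log_nonpos hc.le hc1
  have hlCc : Real.log (C / c) = Real.log C - Real.log c := Real.log_div hC.ne' hc.ne'
  have h1 : α - 1 ≠ 0 := by linarith
  have e : (α - 1) * (ε + (1 + θ) * (1 - 1 / αh) * εh + (α / (α - 1) + 1 + θ) * Real.log (C / c)
        + (1 + θ) / αh * Real.log (1 / γ) + Real.log E / (α - 1)) =
      (α - 1) * ε + (α - 1) * (1 + θ) * ((1 - 1 / αh) * εh + 1 / αh * Real.log (1 / γ))
        + α * Real.log (C / c) + (α - 1) * (1 + θ) * Real.log (C / c) + Real.log E := by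
    set L := Real.log (1 / γ)
    set L2 := Real.log (C / c)
    set x := 1 / αh with hx
    rw [show (1 + θ) / αh = (1 + θ) * x by rw [hx]; ring]
    field_simp
    ring
  rw [e, hlJ, hlCc]
  nlinarith

/-- **DP-HyPO privacy guarantee (Rényi DP, truncated negative binomial stopping).**
If every base algorithm `M λ` (on either of two neighbouring inputs) is `(α, ε)`-RDP and
`(αh, εh)`-RDP, the number of runs follows `NegBin(θ, γ)`, and `σ, σ'` are adaptive
strategies with density bounds `(c, C)`, then the Rényi divergence of order `α` between
the two DP-HyPO output distributions is at most
`ε + (1+θ)(1 - 1/αh) εh + (α/(α-1) + 1 + θ) log(C/c) + ((1+θ)/αh) log(1/γ)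
  + log 𝔼[T] / (α-1)`. -/
theorem dp_hypo_renyi_negBin {Λ Y : Type*} [Fintype Λ] [Nonempty Λ]
    [Countable Y] [LinearOrder Y]
    (α αh ε εh θ γ c C : ℝ)
    (hα : 1 < α) (hαh : 1 ≤ αh) (hε : 0 ≤ ε) (hεh : 0 ≤ εh)
    (hθ : -1 < θ) (hγ0 : 0 < γ) (hγ1 : γ < 1) (hc : 0 < c) (hcC : c ≤ C)
    (M M' : Λ → Y → ℝ≥0∞)
    (hM : ∀ l : Λ, ∑' y : Y, M l y = 1) (hM' : ∀ l : Λ, ∑' y : Y, M' l y = 1)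
    (hRDP : ∀ l : Λ, renyiDiv α (M l) (M' l) ≤ (ε : EReal) ∧
      renyiDiv α (M' l) (M l) ≤ (ε : EReal))
    (hRDPhat : ∀ l : Λ, renyiDiv αh (M l) (M' l) ≤ (εh : EReal) ∧
      renyiDiv αh (M' l) (M l) ≤ (εh : EReal))
    (p : ℕ → ℝ≥0∞) (hp : ∀ k : ℕ, p (k + 1) = ENNReal.ofReal (negBinPMF θ γ (k + 1)))
    (σ σ' : List Y → Λ → ℝ≥0∞)
    (hσ : IsStrategy c C σ) (hσ' : IsStrategy c C σ') :
    renyiDiv α (hypoOut p σ M) (hypoOut p σ' M') ≤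
      ((ε + (1 + θ) * (1 - 1 / αh) * εh + (α / (α - 1) + 1 + θ) * Real.log (C / c)
        + (1 + θ) / αh * Real.log (1 / γ)
        + Real.log (negBinMean θ γ) / (α - 1) : ℝ) : EReal) := by
  have hc1 : c ≤ 1 := c_le_one hσ
  have hC1 : 1 ≤ C := one_le_C hσ
  have hC0 : 0 < C := by linarith
  have hJ := JJ_pos (αh := αh) (εh := εh) hγ0
  have hJ' : 0 < C / c * JJ αh εh γ := by positivity
  have hE := negBinMean_pos (θ := θ) hγ0 hγ1
  refine renyiDiv_le_of_sum_le hα ?_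
  have hpt : ∀ y, hypoOut p σ M y ^ α * hypoOut p σ' M' y ^ (1 - α) ≤
      (ENNReal.ofReal C ^ α * ENNReal.ofReal c ^ (1 - α) * ENNReal.ofReal (negBinMean θ γ) *
        ENNReal.ofReal ((C / c * JJ αh εh γ) ^ (1 + θ)) ^ (α - 1)) *
        (BB M y ^ α * BB M' y ^ (1 - α)) := by
    intro y
    have hgt : ∀ m : Y → ℝ≥0∞, msum m (fun z => ¬ (y < z)) = ∑' z, if z ≤ y then m z else 0 := by
      intro m
      exact tsum_congr fun z => by simp only [not_lt]
    have hge : ∀ m : Y → ℝ≥0∞, msum m (fun z => ¬ (y ≤ z)) = ∑' z, if z < y then m z else 0 := by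
      intro m
      exact tsum_congr fun z => by simp only [not_le]
    let x1 := 1 - ENNReal.ofReal c * msum (BB M) (fun z => y < z)
    let x0 := 1 - ENNReal.ofReal c * msum (BB M) (fun z => y ≤ z)
    let x1' := 1 - ENNReal.ofReal C * msum (BB M') (fun z => y < z)
    let x0' := 1 - ENNReal.ofReal C * msum (BB M') (fun z => y ≤ z)
    have hx1 : x1 ≤ 1 := tsub_le_self
    have hx0 : x0 ≤ 1 := tsub_le_self
    have hx1' : x1' ≤ 1 := tsub_le_self
    have hx0' : x0' ≤ 1 := tsub_le_self
    have hR : ∀ x : ℝ≥0∞, x ≤ 1 → ENNReal.ofReal x.toReal = x := fun x hx =>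
      ENNReal.ofReal_toReal (ne_top_of_le_ne_top ENNReal.one_ne_top hx)
    have hR1 : ∀ x : ℝ≥0∞, x ≤ 1 → x.toReal ≤ 1 := fun x hx => by
      simpa using ENNReal.toReal_mono ENNReal.one_ne_top hx
    have hcmp := G_tsum_compare hθ hγ0 hγ1 (a := x1.toReal) (b := x0.toReal) (a' := x1'.toReal)
      (b' := x0'.toReal) ENNReal.toReal_nonneg ENNReal.toReal_nonneg (hR1 _ hx1) (hR1 _ hx0)
      ENNReal.toReal_nonneg ENNReal.toReal_nonneg (hR1 _ hx1') (hR1 _ hx0') hJ'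
      (key_ineq hαh hγ0 hγ1 hc hc1 hC1 hM hM' (fun l => (hRDPhat l).2) _)
      (key_ineq hαh hγ0 hγ1 hc hc1 hC1 hM hM' (fun l => (hRDPhat l).2) _)
    rw [hR _ hx1, hR _ hx0, hR _ hx1', hR _ hx0'] at hcmp
    refine pointwise_bound hα ?_ ?_ hcmp (G_tsum_le_mean hθ hγ0 hγ1 hx1 hx0) ENNReal.ofReal_ne_top ?_ ?_
    · rw [hypoOut_eq, ← ENNReal.tsum_mul_left]
      refine ENNReal.tsum_le_tsum fun k => ?_
      rw [hp, mul_left_comm]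
      gcongr
      exact VV_le (fun h => by rw [← hgt]; exact msum_step_le hσ hM _ h)
        (fun h => by rw [← hge]; exact msum_step_le hσ hM _ h) (fun h => stepP_le hσ M h y) k []
    · rw [hypoOut_eq, ← ENNReal.tsum_mul_left]
      refine ENNReal.tsum_le_tsum fun k => ?_
      rw [hp, mul_left_comm]
      gcongr
      exact VV_ge (fun h => by rw [← hgt]; exact le_msum_step hσ' hM' _ h)
        (fun h => by rw [← hge]; exact le_msum_step hσ' hM' _ h) (fun h => le_stepP hσ' M' h y) k []
    · exact ENNReal.ne_top_of_tsum_ne_top (by rw [BB_sum hM']; simp) y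
    · exact ne_top_of_le_ne_top ENNReal.ofReal_ne_top (G_tsum_le_mean hθ hγ0 hγ1 hx1' hx0')
  refine (ENNReal.tsum_le_tsum hpt).trans ?_
  rw [ENNReal.tsum_mul_left]
  refine (mul_le_mul_right (BB_convex hα hM hM' (fun l => (hRDP l).1)) _).trans ?_
  rw [ENNReal.ofReal_rpow_of_pos hC0, ENNReal.ofReal_rpow_of_pos hc,
    ENNReal.ofReal_rpow_of_pos (by positivity), ← ENNReal.ofReal_mul (by positivity),
    ← ENNReal.ofReal_mul (by positivity), ← ENNReal.ofReal_mul (by positivity),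
    ← ENNReal.ofReal_mul (by positivity)]
  exact ENNReal.ofReal_le_ofReal (final_const hα hγ0 hc hc1 hC0 hE)
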